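/- arXiv:1004.4761 — 3 statements merged into one kernel-verified Lean document; each statement's English description precedes it below -/
import Mathlib

section
/- Let A be a complex m×n matrix of rank r, and let (AA*)_{i.}(a*_{j.}) denote the m×m matrix obtained from AA* by replacing its i-th row with the j-th row of A*. Then rank((AA*)_{i.}(a*_{j.})) ≤ r. -/
open Matrix

theorem rank_updateRow_le (m n r : ℕ) (A : Matrix (Fin m) (Fin n) ℂ)
    (hr : A.rank = r) (i : Fin m) (j : Fin n) :
    ((A * Aᴴ).updateRow i (Aᴴ j)).rank ≤ r := by
  have h : (A * Aᴴ).updateRow i (Aᴴ j) = (A.updateRow i (Pi.single j 1)) * Aᴴ := by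
    rw [updateRow_mul, single_one_vecMul]
    rfl
  have h2 : Aᴴ.rank = A.rank := by
    open scoped ComplexOrder in exact rank_conjTranspose A
  rw [h, ← hr, ← h2]
  exact rank_mul_le_right _ _
end

section
/- Let A be a complex m×n matrix of rank r. Then the (i,j) entry of A⁺ equals (Σ_{α ∈ I_{r,m}{j}} |((AA*)_{j.}(a*_{i.}))_α^α|) / (Σ_{α ∈ I_{r,m}} |(AA*)_α^α|), where I_{r,m}{j} is the set of r-element subsets of {1,…,m} containing j, and (AA*)_{j.}(a*_{i.}) is AA* with its j-th row replaced by the i-th row of A*. -/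
open Matrix Finset

section Helpers

open Polynomial

/-- Minors indexed through the order embedding agree with minors indexed by the subtype. -/
lemma aux_det_orderEmb {m r : ℕ} (M : Matrix (Fin m) (Fin m) ℂ) (α : Finset (Fin m))
    (h : α.card = r) :
    det (M.submatrix (α.orderEmbOfFin h) (α.orderEmbOfFin h)) =
      det (M.submatrix (Subtype.val : α → Fin m) (Subtype.val : α → Fin m)) := by
  rw [← det_submatrix_equiv_self (α.orderIsoOfFin h).toEquiv
    (M.submatrix (Subtype.val : α → Fin m) (Subtype.val : α → Fin m))]
  rfl

/-- Generating function for the principal minors containing `j`. -/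
lemma aux_key {m : ℕ} (B : Matrix (Fin m) (Fin m) ℂ) (j : Fin m) (v : Fin m → ℂ) (k : ℕ) :
    (X * det (updateRow (1 + (X : ℂ[X]) • B.map C) j (fun l => C (v l)))).coeff k =
      ∑ s ∈ Finset.univ.powersetCard k, if j ∈ s then
        ((B.updateRow j v).submatrix (Subtype.val : s → Fin m) (Subtype.val : s → Fin m)).det
        else 0 := by
  have e : ∀ w : Fin m → ℂ, det (1 + (X : ℂ[X]) • (B.updateRow j w).map C) =
      det (updateRow (1 + (X : ℂ[X]) • B.map C) j ((1 : Matrix (Fin m) (Fin m) ℂ[X]) j)) +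
      X * det (updateRow (1 + (X : ℂ[X]) • B.map C) j (fun l => C (w l))) := by
    intro w
    rw [← det_updateRow_smul, ← det_updateRow_add]
    congr 1
    ext1 a b
    by_cases h : a = j
    · subst h; simp
    · simp [h]
  have e0 : det (updateRow (1 + (X : ℂ[X]) • B.map C) j
      (fun l => C ((0 : Fin m → ℂ) l))) = 0 := by
    apply det_eq_zero_of_row_eq_zero j
    simp
  have h1 := coeff_det_one_add_X_smul_eq_sum_minors (B.updateRow j v) k
  have h2 := coeff_det_one_add_X_smul_eq_sum_minors (B.updateRow j 0) k
  rw [e, coeff_add] at h1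
  rw [e, e0, mul_zero, add_zero] at h2
  rw [h2] at h1
  rw [← sub_eq_iff_eq_add'.mpr h1.symm, ← Finset.sum_sub_distrib]
  refine Finset.sum_congr rfl fun s _ => ?_
  by_cases hj : j ∈ s
  · rw [if_pos hj, det_eq_zero_of_row_eq_zero (A := (B.updateRow j 0).submatrix
      (Subtype.val : s → Fin m) (Subtype.val : s → Fin m)) ⟨j, hj⟩ (by simp), sub_zero]
  · rw [if_neg hj, sub_eq_zero]
    congr 1
    ext a b
    have : (a : Fin m) ≠ j := fun h => hj (h ▸ a.2)
    simp [this]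

lemma aux_vanish {m r : ℕ} (B : Matrix (Fin m) (Fin m) ℂ) (hB : B.rank ≤ r) (j : Fin m)
    (z : Fin m → ℂ) (s : Finset (Fin m)) (hs : s.card = r + 1) :
    ((B.updateRow j (z ᵥ* B)).submatrix
      (Subtype.val : s → Fin m) (Subtype.val : s → Fin m)).det = 0 := by
  by_contra h
  have h1 := rank_of_det_ne_zero h
  have h2 : B.updateRow j (z ᵥ* B) = (updateRow 1 j z) * B := by
    rw [updateRow_mul, Matrix.one_mul]
  have h3 := rank_submatrix_le (B.updateRow j (z ᵥ* B))
    (Subtype.val : s → Fin m) (Subtype.val : s → Fin m)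
  rw [h1, h2] at h3
  have h4 := rank_mul_le_right (updateRow 1 j z) B
  simp at h3
  omega

lemma aux_main {m r : ℕ} (B : Matrix (Fin m) (Fin m) ℂ) (hB : B.rank ≤ r) (j : Fin m)
    (x z : Fin m → ℂ) (hx : x = z ᵥ* B) :
    (∑ s ∈ Finset.univ.powersetCard r, if j ∈ s then
        ((B.updateRow j (x ᵥ* B)).submatrix
          (Subtype.val : s → Fin m) (Subtype.val : s → Fin m)).det else 0) =
    x j * ∑ s ∈ Finset.univ.powersetCard r,
        (B.submatrix (Subtype.val : s → Fin m) (Subtype.val : s → Fin m)).det := by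
  set Q : Matrix (Fin m) (Fin m) ℂ[X] := 1 + (X : ℂ[X]) • B.map C with hQ
  have hv : (X : ℂ[X]) • (fun l => C ((x ᵥ* B) l)) =
      ((fun l => C (x l)) ᵥ* Q) + (-1 : ℂ[X]) • (fun l => C (x l)) := by
    rw [hQ, vecMul_add, vecMul_one, vecMul_smul]
    ext1 l
    simp [vecMul, dotProduct]
  have hdet : det (updateRow Q j ((fun l => C (x l)) ᵥ* Q)) = C (x j) * det Q := by
    have : updateRow Q j ((fun l => C (x l)) ᵥ* Q) = (updateRow 1 j (fun l => C (x l))) * Q := by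
      rw [updateRow_mul, Matrix.one_mul]
    rw [this, det_mul]
    congr 1
    rw [← cramer_transpose_apply]
    simp
  have hz : (det (updateRow Q j (fun l => C (x l)))).coeff r = 0 := by
    rw [← coeff_X_mul, hQ, aux_key]
    refine Finset.sum_eq_zero fun s hs => ?_
    split_ifs
    · rw [hx]
      exact aux_vanish B hB j z s (Finset.mem_powersetCard.mp hs).2
    · rfl
  rw [← aux_key, ← hQ, ← det_updateRow_smul, hv, det_updateRow_add, det_updateRow_smul, hdet,
    coeff_add, coeff_C_mul, hQ, coeff_det_one_add_X_smul_eq_sum_minors, ← hQ]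
  simp [hz]

lemma aux_ne {m r : ℕ} (B : Matrix (Fin m) (Fin m) ℂ) (hH : B.IsHermitian) (hB : B.rank = r) :
    ∑ s ∈ Finset.univ.powersetCard r,
        (B.submatrix (Subtype.val : s → Fin m) (Subtype.val : s → Fin m)).det ≠ 0 := by
  have hrm : r ≤ Fintype.card (Fin m) := hB ▸ rank_le_card_width B
  intro h0
  have h := charpoly_coeff_eq_sum_minors B r hrm
  rw [h0, mul_zero, hH.charpoly_eq,
    ← Finset.prod_filter_mul_prod_filter_not Finset.univ (fun i => hH.eigenvalues i ≠ 0)] at h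
  have hc : (Finset.univ.filter (fun i => hH.eigenvalues i ≠ 0)).card = r := by
    rw [← hB, hH.rank_eq_card_non_zero_eigs, Fintype.card_subtype]
  have hc' := Finset.card_filter_add_card_filter_not (s := (Finset.univ : Finset (Fin m)))
    (fun i => hH.eigenvalues i ≠ 0)
  have h2 : ∏ i ∈ Finset.univ.filter (fun i => ¬ hH.eigenvalues i ≠ 0),
      (X - C ((hH.eigenvalues i : ℝ) : ℂ)) = X ^ (Fintype.card (Fin m) - r) := by
    rw [Finset.prod_congr rfl (g := fun _ => (X : ℂ[X])), Finset.prod_const]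
    · congr 1
      rw [Finset.card_univ] at hc'
      omega
    · intro i hi
      have : hH.eigenvalues i = 0 := by simpa using hi
      simp [this]
  erw [h2] at h
  have h3 := coeff_mul_X_pow (∏ i ∈ Finset.univ.filter (fun i => hH.eigenvalues i ≠ 0),
      (X - C ((hH.eigenvalues i : ℝ) : ℂ))) (Fintype.card (Fin m) - r) 0
  rw [zero_add] at h3
  have h4 := h3.symm.trans h
  rw [coeff_zero_eq_eval_zero, eval_prod, Finset.prod_eq_zero_iff] at h4
  obtain ⟨i, hi, hi'⟩ := h4
  simp at hi hi'
  exact hi hi'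

open scoped ComplexOrder in
lemma aux_rank {m n : ℕ} (A : Matrix (Fin m) (Fin n) ℂ) : (A * Aᴴ).rank = A.rank :=
  rank_self_mul_conjTranspose A

end Helpers

theorem moorePenrose_det_rep_right (m n r : ℕ) (hr1 : 1 ≤ r)
    (A : Matrix (Fin m) (Fin n) ℂ) (hr : A.rank = r)
    (Ap : Matrix (Fin n) (Fin m) ℂ)
    (h1 : A * Ap * A = A) (h2 : Ap * A * Ap = Ap)
    (h3 : (A * Ap)ᴴ = A * Ap) (h4 : (Ap * A)ᴴ = Ap * A) :
    ∀ (i : Fin n) (j : Fin m),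
      Ap i j =
        (∑ α : Finset (Fin m), if j ∈ α then
            (if h : α.card = r then
              det (((A * Aᴴ).updateRow j (Aᴴ i)).submatrix
                (α.orderEmbOfFin h) (α.orderEmbOfFin h)) else 0) else 0) /
        (∑ α : Finset (Fin m), if h : α.card = r then
            det ((A * Aᴴ).submatrix (α.orderEmbOfFin h) (α.orderEmbOfFin h)) else 0) := by
  intro i j
  have hB : (A * Aᴴ).rank = r := by rw [aux_rank, hr]
  have hset : Finset.univ.powersetCard r =
      Finset.univ.filter (fun s : Finset (Fin m) => s.card = r) := by
    ext s; simp [Finset.mem_powersetCard]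
  -- the rows of `Aᴴ` and of `Ap` lie in the row space of `A * Aᴴ`
  have ha : Ap * (A * Aᴴ) = Aᴴ := by
    rw [← Matrix.mul_assoc, ← h4, ← conjTranspose_mul, ← Matrix.mul_assoc, h1]
  have hp : Ap = (Ap * Apᴴ * Ap) * (A * Aᴴ) := by
    rw [Matrix.mul_assoc, ha, Matrix.mul_assoc, ← conjTranspose_mul, h3, ← Matrix.mul_assoc, h2]
  have ha' : Aᴴ i = (Ap i) ᵥ* (A * Aᴴ) := by
    conv_lhs => rw [← ha]
    rfl
  have hp' : Ap i = ((Ap * Apᴴ * Ap) i) ᵥ* (A * Aᴴ) := by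
    conv_lhs => rw [hp]
    rfl
  have hnum : (∑ α : Finset (Fin m), if j ∈ α then
            (if h : α.card = r then
              det (((A * Aᴴ).updateRow j (Aᴴ i)).submatrix
                (α.orderEmbOfFin h) (α.orderEmbOfFin h)) else 0) else 0) =
      ∑ s ∈ Finset.univ.powersetCard r, if j ∈ s then
        (((A * Aᴴ).updateRow j (Ap i ᵥ* (A * Aᴴ))).submatrix
          (Subtype.val : s → Fin m) (Subtype.val : s → Fin m)).det else 0 := by
    rw [hset, Finset.sum_filter, ← ha']
    refine Finset.sum_congr rfl fun s _ => ?_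
    by_cases hj : j ∈ s <;> by_cases hs : s.card = r <;> simp [hj, hs, aux_det_orderEmb]
  have hden : (∑ α : Finset (Fin m), if h : α.card = r then
            det ((A * Aᴴ).submatrix (α.orderEmbOfFin h) (α.orderEmbOfFin h)) else 0) =
      ∑ s ∈ Finset.univ.powersetCard r,
        ((A * Aᴴ).submatrix (Subtype.val : s → Fin m) (Subtype.val : s → Fin m)).det := by
    rw [hset, Finset.sum_filter]
    refine Finset.sum_congr rfl fun s _ => ?_
    by_cases hs : s.card = r <;> simp [hs, aux_det_orderEmb]
  rw [hnum, hden, aux_main (A * Aᴴ) hB.le j (Ap i) _ hp']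
  rw [mul_div_cancel_right₀ _ (aux_ne _ (isHermitian_mul_conjTranspose_self A) hB)]
end

section
/- Let A be a complex m×n matrix of rank r. Then the (i,j) entry of the projection Q = AA⁺ equals (Σ_{α ∈ I_{r,m}{j}} |((AA*)_{j.}(g_{i.}))_α^α|) / (Σ_{α ∈ I_{r,m}} |(AA*)_α^α|), where g_{i.} is the i-th row of AA*. -/
open Matrix Finset

open Polynomial in
lemma aux_N_entry {m : ℕ} (G : Matrix (Fin m) (Fin m) ℂ) (i j : Fin m) (k : ℕ) :
    ((((X : ℂ[X]) • G.map C) * adjugate (1 + (X : ℂ[X]) • G.map C) : Matrix (Fin m) (Fin m) ℂ[X]) i j).coeff k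
      = ∑ s ∈ Finset.univ.powersetCard k, if j ∈ s then
        (((G.updateRow j (G i))).submatrix (Subtype.val : s → Fin m) (Subtype.val : s → Fin m)).det
        else 0 := by
  have e1 : ((((X : ℂ[X]) • G.map C) * adjugate (1 + (X : ℂ[X]) • G.map C) : Matrix (Fin m) (Fin m) ℂ[X]) i j)
      = ((1 + (X : ℂ[X]) • G.map C).updateRow j (((X : ℂ[X]) • G.map C) i)).det := by
    rw [← cramer_transpose_apply, cramer_eq_adjugate_mulVec, ← adjugate_transpose,
      mulVec_transpose]
    rfl
  have e2 : (1 + (X : ℂ[X]) • (G.updateRow j (G i)).map C).det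
      = ((1 + (X : ℂ[X]) • G.map C).updateRow j (((X : ℂ[X]) • G.map C) i)).det
        + (1 + (X : ℂ[X]) • (G.updateRow j 0).map C).det := by
    have a1 : (1 + (X : ℂ[X]) • (G.updateRow j (G i)).map C)
        = (1 + (X : ℂ[X]) • G.map C).updateRow j
            ((((X : ℂ[X]) • G.map C) i) + (1 : Matrix (Fin m) (Fin m) ℂ[X]) j) := by
      ext1 a b
      by_cases h : a = j
      · subst h; simp [add_comm]
      · simp [updateRow_apply, h]
    have a2 : (1 + (X : ℂ[X]) • (G.updateRow j 0).map C)
        = (1 + (X : ℂ[X]) • G.map C).updateRow j ((1 : Matrix (Fin m) (Fin m) ℂ[X]) j) := by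
      ext1 a b
      by_cases h : a = j
      · subst h; simp
      · simp [updateRow_apply, h]
    rw [a1, a2, det_updateRow_add]
  rw [e1, ← sub_eq_of_eq_add e2, coeff_sub, coeff_det_one_add_X_smul_eq_sum_minors,
    coeff_det_one_add_X_smul_eq_sum_minors, ← Finset.sum_sub_distrib]
  refine Finset.sum_congr rfl fun s _ => ?_
  split_ifs with h
  · rw [det_eq_zero_of_row_eq_zero (A := (G.updateRow j 0).submatrix _ _) ⟨j, h⟩, sub_zero]
    intro b; simp
  · rw [sub_eq_zero]
    congr 1
    ext a b
    have : (a : Fin m) ≠ j := fun h' => h (h' ▸ a.2)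
    simp [updateRow_apply, this]

lemma aux_minor_zero {m : ℕ} (G : Matrix (Fin m) (Fin m) ℂ) (i j : Fin m) (s : Finset (Fin m))
    (hs : G.rank < s.card) :
    (((G.updateRow j (G i))).submatrix (Subtype.val : s → Fin m) (Subtype.val : s → Fin m)).det
      = 0 := by
  by_contra h
  have h1 := rank_of_isUnit _ ((isUnit_iff_isUnit_det _).2 (isUnit_iff_ne_zero.2 h))
  have h2 : (G.updateRow j (G i)) = G.submatrix (fun a => if a = j then i else a) id := by
    ext a b
    by_cases h : a = j <;> simp [updateRow_apply, h]
  rw [h2, submatrix_submatrix] at h1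
  have h3 := rank_submatrix_le G ((fun a => if a = j then i else a) ∘ (Subtype.val : s → Fin m))
    (id ∘ (Subtype.val : s → Fin m))
  simp at h1
  simp at h3
  omega

open Polynomial in
lemma aux_ne_zero {m : ℕ} (G : Matrix (Fin m) (Fin m) ℂ) (hG : G.IsHermitian) :
    ∑ s ∈ Finset.univ.powersetCard G.rank,
      (G.submatrix (Subtype.val : s → Fin m) (Subtype.val : s → Fin m)).det ≠ 0 := by
  have hle : G.rank ≤ Fintype.card (Fin m) := rank_le_card_width G
  have h := charpoly_coeff_eq_sum_minors G G.rank hle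
  intro h0
  rw [h0, mul_zero, hG.charpoly_eq,
    ← Finset.prod_filter_mul_prod_filter_not _ (fun i => hG.eigenvalues i = 0)] at h
  have e1 : ∏ x with hG.eigenvalues x = 0, (X - C ((hG.eigenvalues x : ℝ) : ℂ))
      = X ^ (Fintype.card (Fin m) - G.rank) := by
    rw [Finset.prod_congr rfl (g := fun _ => (X : ℂ[X])), Finset.prod_const]
    · congr 1
      rw [hG.rank_eq_card_non_zero_eigs, Fintype.card_subtype]
      have := Finset.card_filter_add_card_filter_not (s := (univ : Finset (Fin m)))
        (fun i => hG.eigenvalues i = 0)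
      rw [Finset.card_univ] at this
      simp only [ne_eq]
      omega
    · intro x hx
      simp [(Finset.mem_filter.1 hx).2]
  erw [e1] at h
  rw [mul_comm] at h
  have h' := coeff_mul_X_pow (∏ x with ¬ hG.eigenvalues x = 0, (X - C ((hG.eigenvalues x : ℝ) : ℂ)))
    (Fintype.card (Fin m) - G.rank) 0
  rw [zero_add] at h'
  have h2 := h'.symm.trans h
  rw [coeff_zero_eq_eval_zero, eval_prod, Finset.prod_eq_zero_iff] at h2
  obtain ⟨x, hx, hx2⟩ := h2
  simp at hx hx2
  exact hx hx2

lemma aux_sum {m r : ℕ} (M : Matrix (Fin m) (Fin m) ℂ) (p : Finset (Fin m) → Prop)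
    [DecidablePred p] :
    (∑ α : Finset (Fin m), if p α then (if h : α.card = r then
              det (M.submatrix
                (α.orderEmbOfFin h) (α.orderEmbOfFin h)) else 0) else 0)
    = ∑ s ∈ Finset.univ.powersetCard r, if p s then
      (M.submatrix (Subtype.val : s → Fin m) (Subtype.val : s → Fin m)).det else 0 := by
  have : (Finset.univ.powersetCard r : Finset (Finset (Fin m)))
      = Finset.univ.filter (fun s => s.card = r) := by
    ext s; simp [Finset.mem_powersetCard]
  rw [this, Finset.sum_filter]
  refine Finset.sum_congr rfl fun s _ => ?_
  by_cases hp : p s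
  · by_cases h : s.card = r
    · simp only [hp, h, if_true, dif_pos]
      rw [← det_submatrix_equiv_self (s.orderIsoOfFin h).toEquiv, submatrix_submatrix]
      rfl
    · simp [h]
  · simp [hp]

open Polynomial in
lemma aux_main_s14 {m : ℕ} (G Q : Matrix (Fin m) (Fin m) ℂ) (hGQ : G * Q = G)
    (Y : Matrix (Fin m) (Fin m) ℂ) (hY : G * Y = Q) (i j : Fin m) :
    (∑ s ∈ Finset.univ.powersetCard G.rank, if j ∈ s then
        (((G.updateRow j (G i))).submatrix (Subtype.val : s → Fin m) (Subtype.val : s → Fin m)).det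
        else 0) = (∑ s ∈ Finset.univ.powersetCard G.rank,
      (G.submatrix (Subtype.val : s → Fin m) (Subtype.val : s → Fin m)).det) * Q i j := by
  rw [← aux_N_entry, ← coeff_det_one_add_X_smul_eq_sum_minors]
  set r := G.rank with hr
  set Gc : Matrix (Fin m) (Fin m) ℂ[X] := G.map C with hGc
  set K := 1 + (X : ℂ[X]) • Gc with hK
  set N := ((X : ℂ[X]) • Gc) * adjugate K with hN
  have hz : N.map (fun p => p.coeff (r + 1)) = 0 := by
    ext a b
    simp only [map_apply, Matrix.zero_apply]
    rw [hN, hK, hGc, aux_N_entry]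
    refine Finset.sum_eq_zero fun s hs => ?_
    rw [aux_minor_zero, ite_self]
    rw [(Finset.mem_powersetCard.1 hs).2]; omega
  have hXG : (X : ℂ[X]) • Gc = K - 1 := by rw [hK]; abel
  have hcomm : N = (X : ℂ[X]) • adjugate K * Gc := by
    rw [smul_mul_assoc, ← mul_smul_comm, hN, hXG, mul_sub, sub_mul, adjugate_mul, mul_adjugate]
    simp
  have hNK : N + (X : ℂ[X]) • (N * Gc) = (X : ℂ[X]) • K.det • Gc := by
    have : N * K = (X : ℂ[X]) • K.det • Gc := by
      rw [hN, mul_assoc, adjugate_mul, mul_smul_comm, mul_one, smul_comm]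
    rw [← this]
    have h5 : N * K = N * (1 + (X : ℂ[X]) • Gc) := rfl
    rw [h5, mul_add, mul_one, mul_smul_comm]
  have hmulC : ∀ (P : Matrix (Fin m) (Fin m) ℂ[X]) (k : ℕ),
      (P * Gc).map (fun p => p.coeff k) = P.map (fun p => p.coeff k) * G := by
    intro P k
    ext a b
    simp [mul_apply, hGc, finsetSum_coeff]
  have hrec : N.map (fun p => p.coeff r) * G = K.det.coeff r • G := by
    rw [← hmulC]
    ext a b
    have h1 := congrArg (fun p => p.coeff (r + 1)) (congrFun (congrFun hNK a) b)
    have h2 := congrFun (congrFun hz a) b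
    simp only [map_apply, Matrix.zero_apply] at h2
    simpa [h2, coeff_X_mul, hGc] using h1
  have hNQ : N.map (fun p => p.coeff r) * Q = N.map (fun p => p.coeff r) := by
    rw [hcomm, hmulC, mul_assoc, hGQ]
  have : N.map (fun p => p.coeff r) = K.det.coeff r • Q := by
    rw [← hNQ, ← hY, ← mul_assoc, hrec, smul_mul_assoc]
  simpa using congrFun (congrFun this i) j

theorem projection_det_rep_right (m n r : ℕ)
    (A : Matrix (Fin m) (Fin n) ℂ) (hr : A.rank = r)
    (Ap : Matrix (Fin n) (Fin m) ℂ)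
    (h1 : A * Ap * A = A) (h2 : Ap * A * Ap = Ap)
    (h3 : (A * Ap)ᴴ = A * Ap) (h4 : (Ap * A)ᴴ = Ap * A) :
    ∀ i j : Fin m,
      (A * Ap) i j =
        (∑ α : Finset (Fin m), if j ∈ α then
            (if h : α.card = r then
              det (((A * Aᴴ).updateRow j ((A * Aᴴ) i)).submatrix
                (α.orderEmbOfFin h) (α.orderEmbOfFin h)) else 0) else 0) /
        (∑ α : Finset (Fin m), if h : α.card = r then
            det ((A * Aᴴ).submatrix (α.orderEmbOfFin h) (α.orderEmbOfFin h)) else 0) := by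
  intro i j
  have hrk : (A * Aᴴ).rank = r := by
    open ComplexOrder in
    rw [rank_self_mul_conjTranspose, hr]
  have hGQ : (A * Aᴴ) * (A * Ap) = A * Aᴴ := by
    have : Aᴴ * (A * Ap) = Aᴴ := by
      rw [← h3, ← conjTranspose_mul, h1]
    rw [Matrix.mul_assoc, this]
  have hY : (A * Aᴴ) * (Apᴴ * Ap) = A * Ap := by
    have : Aᴴ * Apᴴ = Ap * A := by rw [← conjTranspose_mul, h4]
    rw [Matrix.mul_assoc, ← Matrix.mul_assoc Aᴴ, this, h2]
  have key := aux_main_s14 (A * Aᴴ) (A * Ap) hGQ _ hY i j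
  have hne := aux_ne_zero (A * Aᴴ) (isHermitian_mul_conjTranspose_self A)
  rw [hrk] at key hne
  have hd := aux_sum (r := r) (A * Aᴴ) (fun _ => True)
  simp only [if_true] at hd
  rw [aux_sum (r := r) _ (fun s => j ∈ s), hd, key, mul_div_cancel_left₀ _ hne]
end
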